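/- arXiv:1011.3594 — 4 statements merged into one kernel-verified Lean document; each statement's English description precedes it below -/
import Mathlib

section
/- There exist constants C > 0 and ε₀ ∈ (0,1) such that for every ε ∈ (0, ε₀], max_{1 ≤ k ≤ K} r*_k((1−ε)λ̄) ≤ C·log(1/ε). -/
open scoped BigOperators Classical

variable {K : ℕ}

/-- The set of active links forming singleton components of the induced subgraph,
i.e. active links with no active neighbour. -/
noncomputable def Sset (G : SimpleGraph (Fin K)) (x : Fin K → Bool) : Finset (Fin K) :=
  Finset.univ.filter (fun k => x k = true ∧ ∀ j, x j = true → ¬ G.Adj k j)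

/-- The number of connected components of the induced subgraph `G(x)` of size `> 1`. -/
noncomputable def hnum (G : SimpleGraph (Fin K)) (x : Fin K → Bool) : ℕ :=
  Nat.card {c : (G.induce {k | x k = true}).ConnectedComponent // 1 < Nat.card c.supp}

/-- `g(x) = γ^{h(x)} ∏ᵢ pᵢ^{xᵢ} qᵢ^{1-xᵢ}`. -/
noncomputable def gON (G : SimpleGraph (Fin K)) (p : Fin K → ℝ) (γ : ℕ)
    (x : Fin K → Bool) : ℝ :=
  (γ : ℝ) ^ hnum G x * ∏ i, (if x i then p i else 1 - p i)

/-- The normalizing constant `E(r)`. -/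
noncomputable def Efun (G : SimpleGraph (Fin K)) (p : Fin K → ℝ) (γ : ℕ) (τ T₀ : ℝ)
    (r : Fin K → ℝ) : ℝ :=
  ∑ x : Fin K → Bool, gON G p γ x * ∏ k ∈ Sset G x, (τ + T₀ * Real.exp (r k))

/-- The stationary probability `p(x; r)` of the on-off state `x`. -/
noncomputable def pON (G : SimpleGraph (Fin K)) (p : Fin K → ℝ) (γ : ℕ) (τ T₀ : ℝ)
    (x : Fin K → Bool) (r : Fin K → ℝ) : ℝ :=
  gON G p γ x * (∏ k ∈ Sset G x, (τ + T₀ * Real.exp (r k))) / Efun G p γ τ T₀ r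

/-- The service rate `s_k(r)` of link `k`. -/
noncomputable def sRate (G : SimpleGraph (Fin K)) (p : Fin K → ℝ) (γ : ℕ) (τ T₀ : ℝ)
    (k : Fin K) (r : Fin K → ℝ) : ℝ :=
  T₀ * Real.exp (r k) / (τ + T₀ * Real.exp (r k)) *
    ∑ x ∈ Finset.univ.filter (fun x : Fin K → Bool => k ∈ Sset G x), pON G p γ τ T₀ x r

/-- `L(r; λ) = Σ_k λ_k r_k − log E(r)`. -/
noncomputable def Lfun (G : SimpleGraph (Fin K)) (p : Fin K → ℝ) (γ : ℕ) (τ T₀ : ℝ)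
    (r lam : Fin K → ℝ) : ℝ :=
  (∑ k, lam k * r k) - Real.log (Efun G p γ τ T₀ r)

/-- The indicator vectors of the independent sets of `G`. -/
def indVecs (G : SimpleGraph (Fin K)) : Set (Fin K → ℝ) :=
  {v | ∃ σ : Fin K → Bool, (∀ i j, σ i = true → σ j = true → ¬ G.Adj i j) ∧
        v = fun i => if σ i then (1 : ℝ) else 0}

/-- `λ` is strictly feasible iff it lies in the interior of the convex hull of the
indicator vectors of the independent sets of `G`. -/
def strictlyFeasible (G : SimpleGraph (Fin K)) (lam : Fin K → ℝ) : Prop :=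
  lam ∈ interior (convexHull ℝ (indVecs G))

/-- The finite set `𝒮` of detailed states `(x, z)`. -/
noncomputable def DS (G : SimpleGraph (Fin K)) : Finset ((Fin K → Bool) × (Fin K → Bool)) :=
  Finset.univ.filter (fun s => ∀ k, k ∉ Sset G s.1 → s.2 k = false)

/-- `g(x, z) = g(x) · (τ')^{|S(x)| − Σ_k z_k} · T₀^{Σ_k z_k}`. -/
noncomputable def gDS (G : SimpleGraph (Fin K)) (p : Fin K → ℝ) (γ : ℕ) (τ T₀ : ℝ)
    (s : (Fin K → Bool) × (Fin K → Bool)) : ℝ :=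
  gON G p γ s.1 *
    τ ^ ((Sset G s.1).card - (Finset.univ.filter (fun k => s.2 k = true)).card) *
    T₀ ^ (Finset.univ.filter (fun k => s.2 k = true)).card

/-- The stationary probability `p((x, z); r)` of the detailed state `(x, z)`. -/
noncomputable def pDS (G : SimpleGraph (Fin K)) (p : Fin K → ℝ) (γ : ℕ) (τ T₀ : ℝ)
    (s : (Fin K → Bool) × (Fin K → Bool)) (r : Fin K → ℝ) : ℝ :=
  gDS G p γ τ T₀ s * Real.exp (∑ k, if s.2 k then r k else 0) / Efun G p γ τ T₀ r

lemma DS_nonempty (G : SimpleGraph (Fin K)) : (DS G).Nonempty :=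
  ⟨⟨fun _ => false, fun _ => false⟩,
    Finset.mem_filter.mpr ⟨Finset.mem_univ _, fun _ _ => rfl⟩⟩

/-- `G* = max_{(x,z) ∈ 𝒮} |log g(x, z)|`. -/
noncomputable def Gstar (G : SimpleGraph (Fin K)) (p : Fin K → ℝ) (γ : ℕ) (τ T₀ : ℝ) : ℝ :=
  (DS G).sup' (DS_nonempty G) (fun s => |Real.log (gDS G p γ τ T₀ s)|)

/-- expansion of the sum over independent sets containing `k` -/
lemma aux_prod {K : ℕ} (S : Finset (Fin K)) (a b : Fin K → ℝ) (k : Fin K) (hk : k ∈ S)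
    (h : a k + b k ≠ 0) :
    a k / (a k + b k) * ∏ j ∈ S, (a j + b j) =
      ∑ Z ∈ S.powerset, if k ∈ Z then (∏ j ∈ Z, a j) * ∏ j ∈ S \ Z, b j else 0 := by
  have h1 := Finset.prod_add a (Function.update b k 0) S
  have h2 : ∏ j ∈ S, (a j + Function.update b k 0 j) = a k * ∏ j ∈ S.erase k, (a j + b j) := by
    rw [← Finset.mul_prod_erase _ _ hk]
    congr 1
    · simp
    · apply Finset.prod_congr rfl
      intro j hj
      rw [Function.update_of_ne (Finset.ne_of_mem_erase hj)]
  rw [← Finset.mul_prod_erase S _ hk, ← mul_assoc, div_mul_cancel₀ _ h, ← h2, h1]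
  apply Finset.sum_congr rfl
  intro Z hZ
  split_ifs with hkZ
  · congr 1
    apply Finset.prod_congr rfl
    intro j hj
    rw [Function.update_of_ne]
    rintro rfl
    exact (Finset.mem_sdiff.mp hj).2 hkZ
  · rw [Finset.prod_eq_zero (i := k) (Finset.mem_sdiff.mpr ⟨hk, hkZ⟩) (by simp), mul_zero]

lemma core_lower {K : ℕ} (I : Finset (Finset (Fin K))) (c : Finset (Fin K) → ℝ)
    (hc : ∀ Z ∈ I, 0 < c Z) (m : ℝ) (hm : 0 < m) (hmc : ∀ Z ∈ I, m ≤ c Z)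
    (r : Fin K → ℝ) (Zs : Finset (Fin K)) (hZs : Zs ∈ I)
    (hM : 0 ≤ ∑ k ∈ Zs, r k) (hr : ∀ k, r k ≤ ∑ k ∈ Zs, r k) (k : Fin K) (l : ℝ) (hl : 0 < l)
    (h : l * ∑ Z ∈ I, c Z * Real.exp (∑ j ∈ Z, r j) ≤
      ∑ Z ∈ I, if k ∈ Z then c Z * Real.exp (∑ j ∈ Z, r j) else 0) :
    Real.log (l * m / ∑ Z ∈ I, c Z) - K * ∑ k ∈ Zs, r k ≤ r k := by
  set M := ∑ k ∈ Zs, r k with hMdef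
  have hW : 0 < ∑ Z ∈ I, c Z := Finset.sum_pos hc ⟨Zs, hZs⟩
  have h1 : m * Real.exp M ≤ ∑ Z ∈ I, c Z * Real.exp (∑ j ∈ Z, r j) := by
    refine le_trans ?_ (Finset.single_le_sum (f := fun Z => c Z * Real.exp (∑ j ∈ Z, r j))
      (fun Z hZ => by have := hc Z hZ; positivity) hZs)
    exact mul_le_mul_of_nonneg_right (hmc _ hZs) (Real.exp_pos _).le
  have h2 : (∑ Z ∈ I, if k ∈ Z then c Z * Real.exp (∑ j ∈ Z, r j) else 0) ≤
      (∑ Z ∈ I, c Z) * Real.exp (r k + K * M) := by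
    rw [Finset.sum_mul]
    apply Finset.sum_le_sum
    intro Z hZ
    have := hc Z hZ
    split_ifs with hk
    · apply mul_le_mul_of_nonneg_left _ this.le
      apply Real.exp_le_exp.mpr
      rw [← Finset.add_sum_erase _ _ hk]
      have h3 : ∑ j ∈ Z.erase k, r j ≤ (Z.erase k).card • M :=
        Finset.sum_le_card_nsmul _ _ _ (fun j _ => hr j)
      have h4 : ((Z.erase k).card : ℝ) ≤ K := by
        have := Finset.card_le_univ (Z.erase k)
        simp only [Fintype.card_fin] at this
        exact_mod_cast this
      rw [nsmul_eq_mul] at h3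
      have := mul_le_mul_of_nonneg_right h4 hM
      linarith
    · positivity
  have h3 : l * m / (∑ Z ∈ I, c Z) ≤ Real.exp (r k + K * M) := by
    rw [div_le_iff₀ hW]
    have h5 : l * m ≤ l * (m * Real.exp M) := by
      have := Real.one_le_exp hM
      have : m * 1 ≤ m * Real.exp M := mul_le_mul_of_nonneg_left this hm.le
      exact mul_le_mul_of_nonneg_left (by linarith) hl.le
    have := mul_le_mul_of_nonneg_left h1 hl.le
    linarith
  have := (Real.log_le_iff_le_exp (by positivity)).mpr h3
  linarith

lemma core {K : ℕ} (I : Finset (Finset (Fin K))) (c : Finset (Fin K) → ℝ)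
    (hc : ∀ Z ∈ I, 0 < c Z) (hI : ∀ k, {k} ∈ I) (hI0 : ∅ ∈ I)
    (lamb : Fin K → ℝ) (hpos : ∀ k, 0 < lamb k)
    (hhull : ∀ u : Fin K → ℝ, (∀ Z ∈ I, ∑ k ∈ Z, u k ≤ 1) → ∑ k, u k * lamb k ≤ 1) :
    ∃ C : ℝ, 0 < C ∧ ∃ ε₀ : ℝ, 0 < ε₀ ∧ ε₀ < 1 ∧
        ∀ ε : ℝ, 0 < ε → ε ≤ ε₀ →
          ∀ r : Fin K → ℝ, (∀ k, (∑ Z ∈ I, if k ∈ Z then c Z * Real.exp (∑ j ∈ Z, r j) else 0)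
             = (1 - ε) * lamb k * ∑ Z ∈ I, c Z * Real.exp (∑ j ∈ Z, r j)) →
            ∀ k, r k ≤ C * Real.log (1 / ε) := by
  by_contra hcon
  push Not at hcon
  obtain ⟨m, hm, hmc⟩ : ∃ m : ℝ, 0 < m ∧ ∀ Z ∈ I, m ≤ c Z := by
    obtain ⟨Z0, hZ0, h0⟩ := Finset.exists_min_image I c ⟨∅, hI0⟩
    exact ⟨c Z0, hc _ hZ0, h0⟩
  have hex : ∀ n : ℕ, ∃ (ε : ℝ) (r : Fin K → ℝ) (Zs : Finset (Fin K)), 0 < ε ∧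
      ε ≤ 1 / ((n : ℝ) + 3) ∧ (∀ k, (∑ Z ∈ I, if k ∈ Z then c Z * Real.exp (∑ j ∈ Z, r j) else 0)
             = (1 - ε) * lamb k * ∑ Z ∈ I, c Z * Real.exp (∑ j ∈ Z, r j)) ∧ Zs ∈ I ∧
      (∀ Z ∈ I, ∑ j ∈ Z, r j ≤ ∑ j ∈ Zs, r j) ∧
      ((n : ℝ) + 1) * Real.log (1 / ε) ≤ ∑ j ∈ Zs, r j := by
    intro n
    have hn : (0:ℝ) ≤ n := n.cast_nonneg
    obtain ⟨ε, h1, h2, r, h3, k, h4⟩ := hcon ((n : ℝ) + 1) (by positivity) (1 / ((n : ℝ) + 3))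
      (by positivity) (by rw [div_lt_one (by positivity)]; linarith)
    obtain ⟨Zs, hZs, hmax⟩ := Finset.exists_max_image I (fun Z => ∑ j ∈ Z, r j) ⟨∅, hI0⟩
    refine ⟨ε, r, Zs, h1, h2, h3, hZs, hmax, ?_⟩
    have := hmax _ (hI k)
    simp only [Finset.sum_singleton] at this
    linarith
  choose ε r Zs hε0 hε1 hs hZs hmax hbig using hex
  set M : ℕ → ℝ := fun n => ∑ j ∈ Zs n, r n j with hMdef
  have hε3 : ∀ n, ε n ≤ 1 / 3 := fun n => (hε1 n).trans (by
    have hn : (0:ℝ) ≤ n := n.cast_nonneg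
    apply one_div_le_one_div_of_le <;> linarith)
  have hlog : ∀ n, 1 ≤ Real.log (1 / ε n) := by
    intro n
    rw [Real.le_log_iff_exp_le (by have := hε0 n; positivity)]
    have h3 : (3:ℝ) ≤ 1 / ε n := by
      rw [le_div_iff₀ (hε0 n)]; have := hε3 n; linarith
    have := Real.exp_one_lt_d9
    linarith
  have hM1 : ∀ n, 1 ≤ M n := by
    intro n
    have hn : (0:ℝ) ≤ n := n.cast_nonneg
    have := hbig n
    have := hlog n
    have h : 1 * 1 ≤ ((n:ℝ)+1) * Real.log (1 / ε n) :=
      mul_le_mul (by linarith) this (by norm_num) (by linarith)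
    simp only [hMdef]; linarith
  have hrM : ∀ n k, r n k ≤ M n := fun n k => by
    have := hmax n _ (hI k)
    simpa using this
  set u : ℕ → Fin K → ℝ := fun n k => r n k / M n with hu
  set W := ∑ Z ∈ I, c Z with hWdef
  have hW : 0 < W := Finset.sum_pos hc ⟨∅, hI0⟩
  have hEpos : ∀ n, m * Real.exp (M n) ≤ ∑ Z ∈ I, c Z * Real.exp (∑ j ∈ Z, r n j) := by
    intro n
    refine le_trans ?_ (Finset.single_le_sum (f := fun Z => c Z * Real.exp (∑ j ∈ Z, r n j))
      (fun Z hZ => by have := hc Z hZ; positivity) (hZs n))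
    exact mul_le_mul_of_nonneg_right (hmc _ (hZs n)) (Real.exp_pos _).le
  -- compactness
  have hbox : ∀ n, u n ∈ Set.Icc (fun k => - |Real.log (lamb k / 2 * m / W)| - K) (fun _ => (1:ℝ)) := by
    intro n
    have hMp : 0 < M n := by linarith [hM1 n]
    constructor
    · intro k
      have h1 := core_lower I c hc m hm hmc (r n) (Zs n) (hZs n) hMp.le (hrM n) k (lamb k / 2)
        (by have := hpos k; positivity) (by
          rw [hs n k]
          apply mul_le_mul_of_nonneg_right
          · have := hpos k
            have := hε3 n
            nlinarith
          · apply Finset.sum_nonneg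
            intro Z hZ
            have := hc Z hZ
            positivity)
      simp only [hu]
      rw [le_div_iff₀ hMp]
      have h2 := neg_abs_le (Real.log (lamb k / 2 * m / W))
      have h3 : |Real.log (lamb k / 2 * m / W)| * 1 ≤ |Real.log (lamb k / 2 * m / W)| * M n :=
        mul_le_mul_of_nonneg_left (hM1 n) (abs_nonneg _)
      have h4 : Real.log (lamb k / 2 * m / W) - K * M n ≤ r n k := h1
      nlinarith
    · intro k
      simp only [hu]
      rw [div_le_one hMp]
      exact hrM n k
  obtain ⟨v, -, φ, hφ, hlim⟩ := isCompact_Icc.tendsto_subseq hbox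
  have hlimZ : ∀ Z : Finset (Fin K), Filter.Tendsto (fun n => ∑ k ∈ Z, u (φ n) k) Filter.atTop
      (nhds (∑ k ∈ Z, v k)) := by
    intro Z
    apply tendsto_finsetSum
    intro k _
    exact (tendsto_pi_nhds.mp hlim) k
  have huZ : ∀ n (Z : Finset (Fin K)), (∑ k ∈ Z, u n k) * M n = ∑ k ∈ Z, r n k := by
    intro n Z
    have hMp : 0 < M n := by linarith [hM1 n]
    simp only [hu]
    rw [← Finset.sum_div, div_mul_cancel₀ _ hMp.ne']
  have hv1 : ∀ Z ∈ I, ∑ k ∈ Z, v k ≤ 1 := by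
    intro Z hZ
    apply le_of_tendsto (hlimZ Z)
    filter_upwards with n
    have hMp : 0 < M (φ n) := by linarith [hM1 (φ n)]
    have h1 : ∑ k ∈ Z, r (φ n) k ≤ M (φ n) := hmax _ Z hZ
    rw [← huZ] at h1
    exact le_of_mul_le_mul_right (by linarith) hMp
  have hvl := hhull v hv1
  have hterm : ∀ Z ∈ I, ∀ᶠ n in Filter.atTop,
      c Z * Real.exp (∑ j ∈ Z, r (φ n) j) * (1 - ∑ k ∈ Z, v k) ≤
        (c Z * (1 - ∑ k ∈ Z, v k)) * (Real.exp (M (φ n)) * ε (φ n) ^ 2) := by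
    intro Z hZ
    rcases (hv1 Z hZ).eq_or_lt with h | h
    · simp [h]
    · set δ := 1 - ∑ k ∈ Z, v k with hδ
      have hδ0 : 0 < δ := by linarith
      have e1 : ∀ᶠ n in Filter.atTop, ∑ k ∈ Z, u (φ n) k < 1 - δ / 2 :=
        (hlimZ Z).eventually (gt_mem_nhds (by linarith))
      have e2 : ∀ᶠ n : ℕ in Filter.atTop, 4 / δ ≤ (n:ℝ) :=
        tendsto_natCast_atTop_atTop.eventually (Filter.eventually_ge_atTop (4 / δ))
      filter_upwards [e1, e2] with n h1 h2
      have hcZ := hc Z hZ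
      have hMp : 0 < M (φ n) := by linarith [hM1 (φ n)]
      have h3 : (n : ℝ) ≤ φ n := by exact_mod_cast hφ.id_le n
      have h4 := hbig (φ n)
      have hL := hlog (φ n)
      have key : ∑ j ∈ Z, r (φ n) j ≤ M (φ n) + -2 * Real.log (1 / ε (φ n)) := by
        rw [← huZ]
        have h5 : (∑ k ∈ Z, u (φ n) k) * M (φ n) ≤ (1 - δ / 2) * M (φ n) :=
          mul_le_mul_of_nonneg_right h1.le hMp.le
        have h6 : 4 ≤ (φ n : ℝ) * δ := by
          rw [div_le_iff₀ hδ0] at h2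
          have := mul_le_mul_of_nonneg_right h3 hδ0.le
          linarith
        have h7 : ((φ n : ℝ) + 1) * Real.log (1 / ε (φ n)) * (δ / 2) ≤ M (φ n) * (δ / 2) :=
          mul_le_mul_of_nonneg_right h4 (by linarith)
        have h8 : 2 * Real.log (1 / ε (φ n)) ≤
            (((φ n : ℝ) + 1) * (δ / 2)) * Real.log (1 / ε (φ n)) :=
          mul_le_mul_of_nonneg_right (by linarith) (by linarith)
        linarith
      have hexp : Real.exp (M (φ n) + -2 * Real.log (1 / ε (φ n))) =
          Real.exp (M (φ n)) * ε (φ n) ^ 2 := by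
        rw [Real.exp_add]
        congr 1
        have : -2 * Real.log (1 / ε (φ n)) = Real.log (ε (φ n)) + Real.log (ε (φ n)) := by
          rw [one_div, Real.log_inv]; ring
        rw [this, Real.exp_add, Real.exp_log (hε0 _)]; ring
      rw [← hexp]
      have := Real.exp_le_exp.mpr key
      have := mul_le_mul_of_nonneg_left this (mul_pos hcZ hδ0).le
      linarith
  have hall := (Filter.eventually_all_finset I).mpr hterm
  set H := ∑ Z ∈ I, c Z * (1 - ∑ k ∈ Z, v k) with hH
  have hfin : ∀ᶠ n in Filter.atTop, m ≤ H * ε (φ n) := by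
    filter_upwards [hall] with n hn
    have h1 := Finset.sum_le_sum hn
    rw [← Finset.sum_mul] at h1
    set E := ∑ Z ∈ I, c Z * Real.exp (∑ j ∈ Z, r (φ n) j) with hE
    have hEn := hEpos (φ n)
    have h2 : ∑ Z ∈ I, c Z * Real.exp (∑ j ∈ Z, r (φ n) j) * (∑ k ∈ Z, v k)
        = (1 - ε (φ n)) * (∑ k, v k * lamb k) * E := by
      have h3 : ∑ k, v k * (∑ Z ∈ I, if k ∈ Z then c Z * Real.exp (∑ j ∈ Z, r (φ n) j) else 0)
          = ∑ k, v k * ((1 - ε (φ n)) * lamb k * E) :=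
        Finset.sum_congr rfl (fun k _ => by rw [hs (φ n) k])
      have h4 : ∑ k, v k * ((1 - ε (φ n)) * lamb k * E) =
          (1 - ε (φ n)) * (∑ k, v k * lamb k) * E := by
        generalize E = E'
        rw [Finset.mul_sum, Finset.sum_mul]
        exact Finset.sum_congr rfl (fun k _ => by ring)
      rw [← h4, ← h3]
      simp_rw [Finset.mul_sum]
      rw [Finset.sum_comm]
      apply Finset.sum_congr rfl
      intro Z _
      simp only [mul_ite, mul_zero]
      rw [← Finset.sum_filter]
      simp only [Finset.filter_mem_eq_inter, Finset.univ_inter]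
      exact Finset.sum_congr rfl (fun k _ => by ring)
    have h5 : ∑ Z ∈ I, c Z * Real.exp (∑ j ∈ Z, r (φ n) j) * (1 - ∑ k ∈ Z, v k)
        = E - (1 - ε (φ n)) * (∑ k, v k * lamb k) * E := by
      rw [← h2, hE, ← Finset.sum_sub_distrib]
      exact Finset.sum_congr rfl (fun k _ => by ring)
    rw [h5] at h1
    have hexp := Real.exp_pos (M (φ n))
    have hE0 : 0 < E := lt_of_lt_of_le (by positivity) hEn
    have h6 : (1 - ε (φ n)) * (∑ k, v k * lamb k) * E ≤ (1 - ε (φ n)) * 1 * E := by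
      apply mul_le_mul_of_nonneg_right _ hE0.le
      apply mul_le_mul_of_nonneg_left hvl
      linarith [hε3 (φ n)]
    have h7 : ε (φ n) * (m * Real.exp (M (φ n))) ≤ ε (φ n) * E :=
      mul_le_mul_of_nonneg_left hEn (hε0 _).le
    have h8 : m * (ε (φ n) * Real.exp (M (φ n))) ≤
        (H * ε (φ n)) * (ε (φ n) * Real.exp (M (φ n))) := by
      have : H * (Real.exp (M (φ n)) * ε (φ n) ^ 2) =
        (H * ε (φ n)) * (ε (φ n) * Real.exp (M (φ n))) := by ring
      rw [← this]
      linarith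
    exact le_of_mul_le_mul_right h8 (mul_pos (hε0 _) hexp)
  have hεlim : Filter.Tendsto (fun n => ε (φ n)) Filter.atTop (nhds 0) := by
    have : Filter.Tendsto ε Filter.atTop (nhds 0) := by
      apply squeeze_zero (fun n => (hε0 n).le) (g := fun n : ℕ => 1 / ((n:ℝ) + 1)) _
        tendsto_one_div_add_atTop_nhds_zero_nat
      intro n
      refine (hε1 n).trans ?_
      have hn : (0:ℝ) ≤ n := n.cast_nonneg
      apply one_div_le_one_div_of_le <;> linarith
    exact this.comp hφ.tendsto_atTop
  have := ge_of_tendsto (hεlim.const_mul H) hfin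
  linarith

/-- Independence of a finset of links. -/
def Indep {K : ℕ} (G : SimpleGraph (Fin K)) (Z : Finset (Fin K)) : Prop :=
  ∀ i ∈ Z, ∀ j ∈ Z, ¬ G.Adj i j

/-- Total weight of the detailed states whose payload set is `Z`. -/
noncomputable def wt {K : ℕ} (G : SimpleGraph (Fin K)) (p : Fin K → ℝ) (γ : ℕ) (τ T₀ : ℝ)
    (Z : Finset (Fin K)) : ℝ :=
  ∑ x : Fin K → Bool, if Z ⊆ Sset G x then
    gON G p γ x * ((∏ _j ∈ Z, T₀) * ∏ _j ∈ Sset G x \ Z, τ) else 0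

lemma gON_pos {K : ℕ} (G : SimpleGraph (Fin K))
    (p : Fin K → ℝ) (hp : ∀ i, p i ∈ Set.Ioo (0 : ℝ) 1)
    (γ : ℕ) (hγ : 1 ≤ γ) (x : Fin K → Bool) : 0 < gON G p γ x := by
  unfold gON
  apply mul_pos
  · have : (0:ℝ) < γ := by exact_mod_cast hγ
    positivity
  · apply Finset.prod_pos
    intro i _
    have := hp i
    split_ifs
    · exact this.1
    · linarith [this.2]

lemma wt_zero {K : ℕ} (G : SimpleGraph (Fin K)) (p : Fin K → ℝ) (γ : ℕ) (τ T₀ : ℝ)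
    (Z : Finset (Fin K)) (h : ¬ Indep G Z) : wt G p γ τ T₀ Z = 0 := by
  unfold wt
  apply Finset.sum_eq_zero
  intro x _
  rw [if_neg]
  intro hs
  apply h
  intro i hi j hj
  have h1 := hs hi
  have h2 := hs hj
  simp only [Sset, Finset.mem_filter, Finset.mem_univ, true_and] at h1 h2
  exact h1.2 j h2.1

lemma wt_pos {K : ℕ} (G : SimpleGraph (Fin K))
    (p : Fin K → ℝ) (hp : ∀ i, p i ∈ Set.Ioo (0 : ℝ) 1)
    (γ : ℕ) (hγ : 1 ≤ γ) (τ T₀ : ℝ) (hτ : 0 < τ) (hT₀ : 0 < T₀)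
    (Z : Finset (Fin K)) (h : Indep G Z) : 0 < wt G p γ τ T₀ Z := by
  unfold wt
  apply Finset.sum_pos'
  · intro x _
    have := gON_pos G p hp γ hγ x
    split_ifs <;> positivity
  · refine ⟨fun i => decide (i ∈ Z), Finset.mem_univ _, ?_⟩
    rw [if_pos]
    · have := gON_pos G p hp γ hγ (fun i => decide (i ∈ Z))
      positivity
    · intro i hi
      simp only [Sset, Finset.mem_filter, Finset.mem_univ, true_and, decide_eq_true_eq]
      exact ⟨hi, fun j hj => h i hi j hj⟩

lemma sum_wt {K : ℕ} (G : SimpleGraph (Fin K)) (p : Fin K → ℝ) (γ : ℕ) (τ T₀ : ℝ)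
    (r : Fin K → ℝ) (P : Finset (Fin K) → Prop) [DecidablePred P] :
    (∑ x : Fin K → Bool, gON G p γ x * ∑ Z ∈ (Sset G x).powerset,
      if P Z then (∏ j ∈ Z, T₀ * Real.exp (r j)) * ∏ _j ∈ Sset G x \ Z, τ else 0) =
    ∑ Z ∈ Finset.univ.filter (Indep G), if P Z then
      wt G p γ τ T₀ Z * Real.exp (∑ j ∈ Z, r j) else 0 := by
  have h1 : (∑ Z ∈ Finset.univ.filter (Indep G), if P Z then
      wt G p γ τ T₀ Z * Real.exp (∑ j ∈ Z, r j) else 0) = ∑ Z, if P Z then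
      wt G p γ τ T₀ Z * Real.exp (∑ j ∈ Z, r j) else 0 := by
    rw [Finset.sum_filter]
    apply Finset.sum_congr rfl
    intro Z _
    by_cases h : Indep G Z
    · rw [if_pos h]
    · rw [if_neg h, wt_zero _ _ _ _ _ _ h]; simp
  rw [h1]
  simp_rw [Finset.mul_sum]
  have h2 : ∀ x : Fin K → Bool, (∑ Z ∈ (Sset G x).powerset, gON G p γ x *
      if P Z then (∏ j ∈ Z, T₀ * Real.exp (r j)) * ∏ _j ∈ Sset G x \ Z, τ else 0) =
      ∑ Z, if Z ⊆ Sset G x then gON G p γ x *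
      (if P Z then (∏ j ∈ Z, T₀ * Real.exp (r j)) * ∏ _j ∈ Sset G x \ Z, τ else 0) else 0 := by
    intro x
    rw [← Finset.sum_filter]
    apply Finset.sum_congr _ (fun _ _ => rfl)
    ext Z; simp
  rw [Finset.sum_congr rfl (fun x _ => h2 x), Finset.sum_comm]
  apply Finset.sum_congr rfl
  intro Z _
  by_cases hP : P Z
  · simp only [if_pos hP, wt]
    rw [Finset.sum_mul]
    apply Finset.sum_congr rfl
    intro x _
    split_ifs
    · rw [Finset.prod_mul_distrib, ← Real.exp_sum]; ring
    · simp
  · simp [hP]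

lemma Efun_eq {K : ℕ} (G : SimpleGraph (Fin K)) (p : Fin K → ℝ) (γ : ℕ) (τ T₀ : ℝ)
    (r : Fin K → ℝ) : Efun G p γ τ T₀ r =
    ∑ Z ∈ Finset.univ.filter (Indep G), wt G p γ τ T₀ Z * Real.exp (∑ j ∈ Z, r j) := by
  have := sum_wt G p γ τ T₀ r (fun _ => True)
  simp only [if_true] at this
  rw [← this]
  unfold Efun
  apply Finset.sum_congr rfl
  intro x _
  rw [← Finset.prod_add]
  congr 1
  exact Finset.prod_congr rfl (fun _ _ => by ring)

lemma sRate_eq {K : ℕ} (G : SimpleGraph (Fin K)) (p : Fin K → ℝ) (γ : ℕ) (τ T₀ : ℝ)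
    (hτ : 0 < τ) (hT₀ : 0 < T₀) (k : Fin K)
    (r : Fin K → ℝ) : sRate G p γ τ T₀ k r = 
    (∑ Z ∈ Finset.univ.filter (Indep G), if k ∈ Z then
      wt G p γ τ T₀ Z * Real.exp (∑ j ∈ Z, r j) else 0) / Efun G p γ τ T₀ r := by
  rw [← sum_wt G p γ τ T₀ r (fun Z => k ∈ Z)]
  unfold sRate pON
  rw [← Finset.sum_div, mul_div_assoc', Finset.mul_sum, Finset.sum_filter]
  congr 1
  apply Finset.sum_congr rfl
  intro x _
  split_ifs with hk
  · have h := aux_prod (Sset G x) (fun j => T₀ * Real.exp (r j)) (fun _ => τ) k hk (by positivity)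
    rw [← h]
    simp only [add_comm τ]
    ring
  · symm
    rw [mul_eq_zero]; right
    apply Finset.sum_eq_zero
    intro Z hZ
    rw [if_neg]
    intro h
    exact hk (Finset.mem_powerset.mp hZ h)

/-- there exist `C > 0` and `ε₀ ∈ (0,1)` such that for all `ε ∈ (0,ε₀]`,
`max_k r*_k((1−ε)λ̄) ≤ C·log(1/ε)` (stated for any `r` with `s_k(r) = (1−ε)λ̄_k`). -/
theorem stmt14
    (K : ℕ) (hK : 1 ≤ K) (G : SimpleGraph (Fin K))
    (p : Fin K → ℝ) (hp : ∀ i, p i ∈ Set.Ioo (0 : ℝ) 1)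
    (γ : ℕ) (hγ : 1 ≤ γ) (τ T₀ : ℝ) (hτ : 0 < τ) (hT₀ : 0 < T₀)
    (lamb : Fin K → ℝ) (hpos : ∀ k, 0 < lamb k)
    (hmem : lamb ∈ convexHull ℝ (indVecs G))
    (hbdry : ∀ ρ : ℝ, 1 < ρ → ρ • lamb ∉ convexHull ℝ (indVecs G))
    : ∃ C : ℝ, 0 < C ∧ ∃ ε₀ : ℝ, 0 < ε₀ ∧ ε₀ < 1 ∧
        ∀ ε : ℝ, 0 < ε → ε ≤ ε₀ →
          ∀ r : Fin K → ℝ, (∀ k, sRate G p γ τ T₀ k r = (1 - ε) * lamb k) →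
            ∀ k, r k ≤ C * Real.log (1 / ε) := by
  obtain ⟨C, hC, ε₀, h0, h1, H⟩ := core (Finset.univ.filter (Indep G)) (wt G p γ τ T₀)
    (fun Z hZ => wt_pos G p hp γ hγ τ T₀ hτ hT₀ Z (Finset.mem_filter.mp hZ).2)
    (fun k => by simp [Indep]) (by simp [Indep]) lamb hpos (by
      intro u hu
      have hconv : Convex ℝ {y : Fin K → ℝ | ∑ k, u k * y k ≤ 1} := by
        apply convex_halfSpace_le
        constructor
        · intro a b
          simp [mul_add, Finset.sum_add_distrib]
        · intro a b
          simp only [Pi.smul_apply, smul_eq_mul, Finset.mul_sum]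
          exact Finset.sum_congr rfl (fun _ _ => by ring)
      refine convexHull_min ?_ hconv hmem
      rintro y ⟨σ, hσ, rfl⟩
      have := hu (Finset.univ.filter (fun i => σ i = true)) (by
        simp only [Finset.mem_filter, Finset.mem_univ, true_and, Indep]
        intro i hi j hj
        exact hσ i j hi hj)
      rw [Finset.sum_filter] at this
      simpa using this)
  refine ⟨C, hC, ε₀, h0, h1, fun ε hε hε' r hr k => H ε hε hε' r (fun k => ?_) k⟩
  have hEpos : 0 < Efun G p γ τ T₀ r := by
    unfold Efun
    apply Finset.sum_pos
    · intro x _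
      have := gON_pos G p hp γ hγ x
      positivity
    · exact Finset.univ_nonempty
  have h := hr k
  rw [sRate_eq G p γ τ T₀ hτ hT₀ k r, div_eq_iff hEpos.ne', Efun_eq] at h
  exact h
end

section
/- Let K and N' be positive integers, let A be a K × N' matrix with entries in {0,1}, let P := { u ∈ ℝ^{N'} : u_i ≥ 0 for all i, Σ_i u_i = 1 } be the probability simplex, and let λ̄ ∈ ℝ^K with λ̄_k > 0 for all k be such that A·z = λ̄ for some z ∈ P. Then there exists a constant b > 0 such that for every ε ∈ (0,1) and every u ∈ P with A·u = (1−ε)·λ̄, there exists ū ∈ P with A·ū = λ̄ and ‖u − ū‖₁ ≤ 2bε. -/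
open scoped BigOperators

/-- Closed cone of vectors conformal to a sign pattern. -/
def conf15 {N : ℕ} (s : Fin N → SignType) : Set (Fin N → ℝ) :=
  {w | ∀ i, (s i = 0 → w i = 0) ∧ 0 ≤ ((s i : SignType) : ℝ) * w i}

lemma conf15_closed {N : ℕ} (s : Fin N → SignType) : IsClosed (conf15 s) := by
  have : conf15 s = ⋂ i, ({w : Fin N → ℝ | s i = 0 → w i = 0} ∩
      {w | 0 ≤ ((s i : SignType) : ℝ) * w i}) := by
    ext w; simp [conf15]
  rw [this]
  refine isClosed_iInter fun i => IsClosed.inter ?_ ?_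
  · by_cases h : s i = 0
    · simp only [h, true_imp_iff]
      exact isClosed_eq (continuous_apply i) continuous_const
    · simp [h]
  · exact isClosed_le continuous_const (continuous_const.mul (continuous_apply i))

lemma bound15 {N : ℕ} {F : Type*} [NormedAddCommGroup F] [NormedSpace ℝ F]
    (L : (Fin N → ℝ) →ₗ[ℝ] F) (s : Fin N → SignType)
    (h : ∀ w ∈ conf15 s, L w = 0 → w = 0) :
    ∃ C : ℝ, 0 ≤ C ∧ ∀ y ∈ conf15 s, ‖y‖ ≤ C * ‖L y‖ := by
  have hL : Continuous L := L.continuous_of_finiteDimensional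
  have hS : IsCompact (Metric.sphere (0 : Fin N → ℝ) 1 ∩ conf15 s) :=
    (isCompact_sphere _ _).inter_right (conf15_closed s)
  have key : ∀ y ∈ conf15 s, y ≠ 0 →
      (‖y‖⁻¹ • y) ∈ Metric.sphere (0 : Fin N → ℝ) 1 ∩ conf15 s := by
    intro y hy hy0
    refine ⟨by simp [norm_smul, hy0], fun i => ⟨fun hi => by simp [(hy i).1 hi], ?_⟩⟩
    have := mul_nonneg (inv_nonneg.2 (norm_nonneg y)) (hy i).2
    simp only [Pi.smul_apply, smul_eq_mul]
    linarith
  rcases (Metric.sphere (0 : Fin N → ℝ) 1 ∩ conf15 s).eq_empty_or_nonempty with he | hne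
  · refine ⟨0, le_rfl, fun y hy => ?_⟩
    by_cases hy0 : y = 0
    · simp [hy0]
    · have := key y hy hy0
      rw [he] at this
      exact this.elim
  · obtain ⟨x, hx, hmin⟩ := hS.exists_isMinOn hne (hL.norm.continuousOn)
    have hx0 : 0 < ‖L x‖ := by
      rw [norm_pos_iff]
      intro h0
      have := h x hx.2 h0
      have h1 := hx.1
      simp [this] at h1
    refine ⟨‖L x‖⁻¹, by positivity, fun y hy => ?_⟩
    by_cases hy0 : y = 0
    · simp [hy0]
    · have h2 := hmin (key y hy hy0)
      have hyp : 0 < ‖y‖ := norm_pos_iff.2 hy0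
      simp only [Set.mem_setOf_eq, map_smul, norm_smul, norm_inv, norm_norm] at h2
      rw [inv_mul_eq_div, le_div_iff₀ hyp] at h2
      rw [inv_mul_eq_div, le_div_iff₀ hx0]
      linarith

lemma reduce15 {N : ℕ} {F : Type*} [NormedAddCommGroup F] [NormedSpace ℝ F]
    (L : (Fin N → ℝ) →ₗ[ℝ] F) (d : Fin N → ℝ) :
    ∃ d' : Fin N → ℝ, (∀ i, d' i ∈ Set.uIcc 0 (d i)) ∧ L d' = L d ∧
      ∀ w ∈ conf15 (fun i => SignType.sign (d' i)), L w = 0 → w = 0 := by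
  have hL : Continuous L := L.continuous_of_finiteDimensional
  have hS : IsCompact ((Set.univ.pi fun i => Set.uIcc 0 (d i)) ∩ {y | L y = L d}) :=
    (isCompact_univ_pi fun i => isCompact_uIcc).inter_right
      (isClosed_eq hL continuous_const)
  obtain ⟨x, hx, hmin⟩ := hS.exists_isMinOn (f := fun y : Fin N → ℝ => ∑ i, |y i|)
    ⟨d, by simp, rfl⟩ (by fun_prop)
  refine ⟨x, fun i => hx.1 i trivial, hx.2, fun w hw hw0 => ?_⟩
  by_contra hne
  have ev : ∀ i, ∃ δ > 0, ∀ t : ℝ, 0 < t → t < δ →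
      x i - t * w i ∈ Set.uIcc 0 (x i) ∧ |x i - t * w i| = |x i| - t * |w i| := by
    intro i
    have hwi := hw i
    rcases lt_trichotomy (x i) 0 with h | h | h
    · have hw1 : w i ≤ 0 := by simpa [sign_neg h] using hwi.2
      refine ⟨-x i / (1 + -w i), by apply div_pos <;> linarith, fun t ht htd => ?_⟩
      rw [lt_div_iff₀ (by linarith)] at htd
      have h3 : 0 ≤ t * -w i := mul_nonneg ht.le (by linarith)
      have h4 : x i - t * w i ≤ 0 := by nlinarith
      refine ⟨?_, ?_⟩
      · rw [Set.uIcc_of_ge h.le]; exact ⟨by linarith, h4⟩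
      · rw [abs_of_nonpos h4, abs_of_neg h, abs_of_nonpos hw1]; ring
    · have hw1 : w i = 0 := hwi.1 (by simp [h])
      exact ⟨1, one_pos, fun t _ _ => by simp [h, hw1]⟩
    · have hw1 : 0 ≤ w i := by simpa [sign_pos h] using hwi.2
      refine ⟨x i / (1 + w i), by apply div_pos <;> linarith, fun t ht htd => ?_⟩
      rw [lt_div_iff₀ (by linarith)] at htd
      have h3 : 0 ≤ t * w i := mul_nonneg ht.le (by linarith)
      have h4 : 0 ≤ x i - t * w i := by nlinarith
      refine ⟨?_, ?_⟩
      · rw [Set.uIcc_of_le h.le]; exact ⟨h4, by linarith⟩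
      · rw [abs_of_nonneg h4, abs_of_pos h, abs_of_nonneg hw1]
  have ev2 : ∀ᶠ t in nhdsWithin (0 : ℝ) (Set.Ioi 0), ∀ i,
      x i - t * w i ∈ Set.uIcc 0 (x i) ∧ |x i - t * w i| = |x i| - t * |w i| := by
    rw [Filter.eventually_all]
    intro i
    obtain ⟨δ, hδ, h⟩ := ev i
    filter_upwards [Ioo_mem_nhdsGT hδ] with t ht using h t ht.1 ht.2
  obtain ⟨t, ht, ht0⟩ := (ev2.and self_mem_nhdsWithin).exists
  have ht0 : 0 < t := ht0
  have hmem : (x - t • w) ∈ (Set.univ.pi fun i => Set.uIcc 0 (d i)) ∩ {y | L y = L d} := by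
    refine ⟨fun i _ => ?_, ?_⟩
    · exact Set.uIcc_subset_uIcc Set.left_mem_uIcc (hx.1 i trivial) (ht i).1
    · have h2 : L x = L d := hx.2
      simp [hw0, h2]
  have h5 := hmin hmem
  simp only [Set.mem_setOf_eq, Pi.sub_apply, Pi.smul_apply, smul_eq_mul] at h5
  rw [Finset.sum_congr rfl fun i _ => (ht i).2, Finset.sum_sub_distrib, ← Finset.mul_sum] at h5
  have h6 : 0 < ∑ i, |w i| := by
    obtain ⟨i, hi⟩ := Function.ne_iff.1 hne
    exact Finset.sum_pos' (fun _ _ => abs_nonneg _) ⟨i, Finset.mem_univ _, abs_pos.2 hi⟩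
  have := mul_pos ht0 h6
  linarith

lemma hoffman15 {N : ℕ} {F : Type*} [NormedAddCommGroup F] [NormedSpace ℝ F]
    (L : (Fin N → ℝ) →ₗ[ℝ] F) :
    ∃ C : ℝ, 0 ≤ C ∧ ∀ d : Fin N → ℝ,
    ∃ d' : Fin N → ℝ, (∀ i, d' i ∈ Set.uIcc 0 (d i)) ∧ L d' = L d ∧ ‖d'‖ ≤ C * ‖L d‖ := by
  have h : ∀ s : Fin N → SignType, ∃ C : ℝ, 0 ≤ C ∧
      ((∀ w ∈ conf15 s, L w = 0 → w = 0) → ∀ y ∈ conf15 s, ‖y‖ ≤ C * ‖L y‖) := by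
    intro s
    by_cases hs : ∀ w ∈ conf15 s, L w = 0 → w = 0
    · obtain ⟨C, h0, h1⟩ := bound15 L s hs
      exact ⟨C, h0, fun _ => h1⟩
    · exact ⟨0, le_rfl, fun h => absurd h hs⟩
  choose C hC0 hC using h
  refine ⟨∑ s, C s, Finset.sum_nonneg fun s _ => hC0 s, fun d => ?_⟩
  obtain ⟨d', h1, h2, h3⟩ := reduce15 L d
  refine ⟨d', h1, h2, ?_⟩
  have h4 := hC _ h3 d' (fun i => ⟨fun h => by simpa using h, by simp [sign_mul_self]⟩)
  rw [← h2]
  refine h4.trans (mul_le_mul_of_nonneg_right ?_ (norm_nonneg _))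
  exact Finset.single_le_sum (fun s _ => hC0 s) (Finset.mem_univ _)

/-- given a 0-1 matrix `A` and `λ̄ ≻ 0` with `A·z = λ̄` for some point `z`
of the simplex, there is `b > 0` such that for every `ε ∈ (0,1)` and every simplex point
`u` with `A·u = (1−ε)λ̄`, there is a simplex point `ū` with `A·ū = λ̄` and
`‖u − ū‖₁ ≤ 2bε`. -/
theorem stmt15 (K N' : ℕ) (hK : 0 < K) (hN : 0 < N')
    (A : Matrix (Fin K) (Fin N') ℝ) (hA : ∀ k i, A k i = 0 ∨ A k i = 1)
    (lamb : Fin K → ℝ) (hpos : ∀ k, 0 < lamb k)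
    (hfeas : ∃ z : Fin N' → ℝ, (∀ i, 0 ≤ z i) ∧ (∑ i, z i) = 1 ∧ A.mulVec z = lamb) :
    ∃ b : ℝ, 0 < b ∧ ∀ ε : ℝ, 0 < ε → ε < 1 →
      ∀ u : Fin N' → ℝ, (∀ i, 0 ≤ u i) → (∑ i, u i) = 1 →
        A.mulVec u = (1 - ε) • lamb →
        ∃ ub : Fin N' → ℝ, (∀ i, 0 ≤ ub i) ∧ (∑ i, ub i) = 1 ∧
          A.mulVec ub = lamb ∧ (∑ i, |u i - ub i|) ≤ 2 * b * ε := by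
  obtain ⟨z, hz0, hz1, hzA⟩ := hfeas
  let L : (Fin N' → ℝ) →ₗ[ℝ] ((Fin K → ℝ) × ℝ) :=
    A.mulVecLin.prod (∑ i, LinearMap.proj i)
  have hLd : ∀ y, L y = (A.mulVec y, ∑ i, y i) := by
    intro y; simp [L]
  obtain ⟨C, hC0, hC⟩ := hoffman15 L
  refine ⟨N' * (C * ‖lamb‖) + 1, by positivity, ?_⟩
  intro ε hε hε1 u hu0 hu1 huA
  obtain ⟨d', h1, h2, h3⟩ := hC (z - u)
  have hLz : L (z - u) = (ε • lamb, 0) := by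
    rw [hLd, Matrix.mulVec_sub, hzA, huA]
    simp only [Pi.sub_apply, Finset.sum_sub_distrib, hz1, hu1, sub_self]
    congr 1
    rw [sub_smul, one_smul]; abel
  rw [hLz] at h2 h3
  rw [hLd, Prod.mk.injEq] at h2
  have hn : ‖((ε • lamb, 0) : (Fin K → ℝ) × ℝ)‖ = ε * ‖lamb‖ := by
    rw [Prod.norm_mk, norm_zero, norm_smul, Real.norm_of_nonneg hε.le]
    exact max_eq_left (by positivity)
  rw [hn] at h3
  refine ⟨u + d', fun i => ?_, ?_, ?_, ?_⟩
  · have := h1 i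
    rw [Set.mem_uIcc] at this
    simp only [Pi.sub_apply, Pi.add_apply] at this ⊢
    rcases this with h | h
    · linarith [hu0 i]
    · linarith [hz0 i]
  · simp [Finset.sum_add_distrib, hu1, h2.2]
  · rw [Matrix.mulVec_add, huA, h2.1, sub_smul, one_smul]; abel
  · calc ∑ i, |u i - (u + d') i| = ∑ i, |d' i| := by simp
      _ ≤ ∑ _i : Fin N', C * (ε * ‖lamb‖) :=
        Finset.sum_le_sum fun i _ => (norm_le_pi_norm d' i).trans h3
      _ = (N' * (C * ‖lamb‖)) * ε := by simp; ring
      _ ≤ _ := by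
        have : 0 ≤ (N' * (C * ‖lamb‖)) * ε := by positivity
        nlinarith
end

section
/- Let N' ≥ 3 be an integer, let u and ū be probability vectors in ℝ^{N'} (nonnegative entries summing to 1) with u ≠ ū, and let c ∈ (0,1] satisfy ‖u − ū‖₁ ≤ 2c. Then |H(u) − H(ū)| ≤ c·( log(N'/c) + 1 ), where H(v) := Σ_{i=1}^{N'} [−v_i·log v_i] (with 0·log 0 := 0). -/
open scoped BigOperators

/-- `-p log p ≤ -p log a - p + a`. -/
lemma aux_tangent (p a : ℝ) (hp : 0 ≤ p) (ha : 0 < a) :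
    Real.negMulLog p ≤ p * (-Real.log a) - p + a := by
  rcases hp.eq_or_lt with rfl | hp
  · simp [ha.le]
  · have h := Real.log_le_sub_one_of_pos (div_pos ha hp)
    rw [Real.log_div ha.ne' hp.ne'] at h
    have h2 := mul_le_mul_of_nonneg_left h hp.le
    have h3 : p * (a / p - 1) = a - p := by field_simp
    rw [h3] at h2
    unfold Real.negMulLog
    linarith

lemma aux_subadd (y p : ℝ) (hy : 0 ≤ y) (hp : 0 ≤ p) :
    Real.negMulLog (y + p) ≤ Real.negMulLog y + Real.negMulLog p := by
  rcases hp.eq_or_lt with rfl | hp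
  · simp
  rcases hy.eq_or_lt with rfl | hy
  · simp
  have h1 := mul_le_mul_of_nonneg_left
    (Real.log_le_log hy (by linarith : y ≤ y + p)) hy.le
  have h2 := mul_le_mul_of_nonneg_left
    (Real.log_le_log hp (by linarith : p ≤ y + p)) hp.le
  unfold Real.negMulLog
  linarith

lemma aux_drop (x y : ℝ) (hx : 0 ≤ x) (hxy : x ≤ y) (hy : y ≤ 1) :
    Real.negMulLog x - Real.negMulLog y ≤ y - x := by
  rcases hx.eq_or_lt with rfl | hx
  · have := Real.negMulLog_nonneg hxy hy
    simp
    linarith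
  have hy0 : 0 < y := by linarith
  have h := Real.log_le_sub_one_of_pos (div_pos hy0 hx)
  rw [Real.log_div hy0.ne' hx.ne'] at h
  have h2 := mul_le_mul_of_nonneg_left h hx.le
  have h3 : x * (y / x - 1) = y - x := by field_simp
  rw [h3] at h2
  have h4 : (y - x) * Real.log y ≤ 0 :=
    mul_nonpos_of_nonneg_of_nonpos (by linarith) (Real.log_nonpos hy0.le hy)
  unfold Real.negMulLog
  linarith

lemma aux_point (x y a : ℝ) (hx : 0 ≤ x) (hy : 0 ≤ y) (hy1 : y ≤ 1) (ha : 0 < a) :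
    Real.negMulLog x - Real.negMulLog y ≤
      (-Real.log a) / 2 * |x - y| + (-Real.log a / 2 - 1) * (x - y) + a := by
  rcases le_total x y with h | h
  · have := aux_drop x y hx h hy1
    rw [abs_of_nonpos (by linarith)]
    linarith
  · have h1 := aux_subadd y (x - y) hy (by linarith)
    have h2 := aux_tangent (x - y) a (by linarith) ha
    rw [abs_of_nonneg (by linarith)]
    rw [add_sub_cancel] at h1
    linarith

lemma aux_one_side (n : ℕ) (hN : 3 ≤ n) (u v : Fin n → ℝ)
    (hu : ∀ i, 0 ≤ u i) (hu1 : (∑ i, u i) = 1)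
    (hv : ∀ i, 0 ≤ v i) (hv1 : (∑ i, v i) = 1)
    (c : ℝ) (hc : c ∈ Set.Ioc (0 : ℝ) 1)
    (hl1 : (∑ i, |u i - v i|) ≤ 2 * c) :
    (∑ i, Real.negMulLog (u i)) - ∑ i, Real.negMulLog (v i) ≤
      c * (Real.log ((n : ℝ) / c) + 1) := by
  obtain ⟨hc0, hc1⟩ := hc
  have hn : (3 : ℝ) ≤ n := by exact_mod_cast hN
  have hn0 : (0 : ℝ) < n := by linarith
  have hL : Real.log ((n : ℝ) / c) = -Real.log (c / n) := by
    rw [← Real.log_inv, inv_div]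
  have hL0 : 0 ≤ Real.log ((n : ℝ) / c) :=
    Real.log_nonneg (by rw [le_div_iff₀ hc0]; linarith)
  have hle : ∀ i, v i ≤ 1 := fun i => by
    rw [← hv1]
    exact Finset.single_le_sum (fun j _ => hv j) (Finset.mem_univ i)
  have key := Finset.sum_le_sum (s := Finset.univ) (fun i _ =>
    aux_point (u i) (v i) (c / n) (hu i) (hv i) (hle i) (div_pos hc0 hn0))
  rw [← hL] at key
  simp only [Finset.sum_add_distrib, ← Finset.mul_sum, Finset.sum_sub_distrib, hu1, hv1,
    Finset.sum_const, Finset.card_univ, Fintype.card_fin, nsmul_eq_mul] at key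
  rw [mul_div_cancel₀ c hn0.ne'] at key
  have := mul_le_mul_of_nonneg_left hl1 (by linarith : 0 ≤ Real.log ((n : ℝ) / c) / 2)
  linarith

/-- if `u ≠ ū` are probability vectors in `ℝ^{N'}` (`N' ≥ 3`) with
`‖u − ū‖₁ ≤ 2c` for some `c ∈ (0,1]`, then `|H(u) − H(ū)| ≤ c·(log(N'/c) + 1)`,
where `H(v) = Σᵢ −vᵢ·log vᵢ`. -/
theorem stmt17 (N' : ℕ) (hN : 3 ≤ N')
    (u ub : Fin N' → ℝ)
    (hu : ∀ i, 0 ≤ u i) (hu1 : (∑ i, u i) = 1)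
    (hub : ∀ i, 0 ≤ ub i) (hub1 : (∑ i, ub i) = 1)
    (hne : u ≠ ub)
    (c : ℝ) (hc : c ∈ Set.Ioc (0 : ℝ) 1)
    (hl1 : (∑ i, |u i - ub i|) ≤ 2 * c) :
    |(∑ i, Real.negMulLog (u i)) - ∑ i, Real.negMulLog (ub i)| ≤
      c * (Real.log ((N' : ℝ) / c) + 1) := by
  rw [abs_le]
  have h1 := aux_one_side N' hN u ub hu hu1 hub hub1 c hc hl1
  have h2 := aux_one_side N' hN ub u hub hub1 hu hu1 c hc
    (by simpa only [abs_sub_comm] using hl1)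
  constructor <;> linarith
end

section
/- Fix real numbers r_min ≤ r_max and λ̄ ≥ 0. Let α(i) ∈ (0,1], λ'(i) ∈ [0, λ̄], and s'(i) ∈ [0,1] for i ≥ 1 be arbitrary sequences, let r(0) ∈ [r_min, r_max], and define recursively r(i) := r(i−1) + α(i)·[ λ'(i) − s'(i) + h̃(r(i−1)) ] for i ≥ 1. Then r(i) ∈ [r_min − 2, r_max + 2λ̄] for every i ≥ 0. -/
/-- The penalty function `h̃`. -/
noncomputable def htil (rmin rmax y : ℝ) : ℝ :=
  if y < rmin then rmin - y else if y ≤ rmax then 0 else rmax - y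

/-- with step sizes `α(i) ∈ (0,1]`, arrival rates `λ'(i) ∈ [0,λ̄]`, service
rates `s'(i) ∈ [0,1]`, initial value `r(0) ∈ [r_min, r_max]` and updates
`r(i) = r(i−1) + α(i)·[λ'(i) − s'(i) + h̃(r(i−1))]`, the iterates stay in
`[r_min − 2, r_max + 2λ̄]`. -/
theorem stmt18 (rmin rmax : ℝ) (hr : rmin ≤ rmax) (lambar : ℝ) (hlb : 0 ≤ lambar)
    (α lam' s' : ℕ → ℝ)
    (hα : ∀ i, 1 ≤ i → α i ∈ Set.Ioc (0 : ℝ) 1)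
    (hlam' : ∀ i, 1 ≤ i → lam' i ∈ Set.Icc (0 : ℝ) lambar)
    (hs' : ∀ i, 1 ≤ i → s' i ∈ Set.Icc (0 : ℝ) 1)
    (r : ℕ → ℝ) (hr0 : r 0 ∈ Set.Icc rmin rmax)
    (hrec : ∀ i, 1 ≤ i →
      r i = r (i - 1) + α i * (lam' i - s' i + htil rmin rmax (r (i - 1)))) :
    ∀ i, r i ∈ Set.Icc (rmin - 2) (rmax + 2 * lambar) := by
  have key : ∀ i, r i ∈ Set.Icc (rmin - 1) (rmax + lambar) := by
    intro i
    induction i with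
    | zero => exact ⟨by linarith [hr0.1], by linarith [hr0.2]⟩
    | succ k ih =>
      have h := hrec (k + 1) (by omega)
      obtain ⟨ha0, ha1⟩ := hα (k + 1) (by omega)
      obtain ⟨hl0, hl1⟩ := hlam' (k + 1) (by omega)
      obtain ⟨hs0, hs1⟩ := hs' (k + 1) (by omega)
      obtain ⟨h1, h2⟩ := ih
      simp only [Nat.add_sub_cancel] at h
      rw [h]
      generalize α (k + 1) = a at *
      generalize lam' (k + 1) = l at *
      generalize s' (k + 1) = s at *
      generalize r k = y at *
      have e1 : 0 ≤ a * l := mul_nonneg ha0.le hl0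
      have e2 : a * l ≤ a * lambar := mul_le_mul_of_nonneg_left hl1 ha0.le
      have e3 : 0 ≤ a * s := mul_nonneg ha0.le hs0
      have e4 : a * s ≤ a * 1 := mul_le_mul_of_nonneg_left hs1 ha0.le
      have e5 : a * lambar ≤ 1 * lambar := mul_le_mul_of_nonneg_right ha1 hlb
      have e6 : 0 ≤ (1 - a) * (y - (rmin - 1)) := mul_nonneg (by linarith) (by linarith)
      have e7 : 0 ≤ (1 - a) * (rmax + lambar - y) := mul_nonneg (by linarith) (by linarith)
      unfold htil
      split_ifs with c1 c2
      · have e8 : 0 ≤ (1 - a) * (rmin - y) := mul_nonneg (by linarith) (by linarith)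
        constructor <;> linarith
      · constructor <;> linarith
      · have e8 : 0 ≤ (1 - a) * (y - rmax) := mul_nonneg (by linarith) (by linarith)
        constructor <;> linarith
  intro i
  exact ⟨by linarith [(key i).1], by linarith [(key i).2]⟩
end
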